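/- arXiv:math/0111071 — 4 statements merged into one kernel-verified Lean document; each statement's English description precedes it below -/
import Mathlib

section
/- Let G be a group, Y a connected G-set (i.e., Y is nonempty and G acts transitively on Y), a ∈ Y a point, and H ≤ G the stabilizer of a. Then the slice category of G-sets over Y (objects: G-equivariant maps Z → Y; morphisms: G-equivariant maps commuting with the projections to Y) is equivalent to the category of H-sets. -/
open CategoryTheory

namespace Action

section

variable {G : Type u} [Monoid G] {A B : Action (Type u) G}

theorem ρ_mul_apply (A : Action (Type u) G) (g h : G) (x : A.V) :
    A.ρ (g * h) x = A.ρ g (A.ρ h x) := by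
  rw [map_mul]
  rfl

theorem ρ_one_apply (A : Action (Type u) G) (x : A.V) : A.ρ 1 x = x := by
  rw [map_one]
  rfl

theorem hom_ρ_apply (f : A ⟶ B) (g : G) (x : A.V) :
    f.hom (A.ρ g x) = B.ρ g (f.hom x) :=
  ConcreteCategory.congr_hom (f.comm g) x

/-- An action on a type from a function `G → X → X` satisfying the action laws. -/
def ofFun (X : Type u) (r : G → X → X) (one : ∀ x, r 1 x = x)
    (mul : ∀ g h x, r (g * h) x = r g (r h x)) : Action (Type u) G where
  V := X
  ρ :=
    { toFun := fun g => ↾(r g)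
      map_one' := congrArg (TypeCat.endEquiv X) (funext one)
      map_mul' := fun g h => congrArg (TypeCat.endEquiv X) (funext (mul g h)) }

/-- A morphism of actions from an equivariant function. -/
def homOfFun (f : A.V → B.V) (hf : ∀ g x, f (A.ρ g x) = B.ρ g (f x)) : A ⟶ B where
  hom := ↾f
  comm := fun g => by
    ext x
    exact hf g x

/-- An isomorphism of actions from an equivariant bijection. -/
def isoOfEquiv (e : A.V ≃ B.V) (he : ∀ g x, e (A.ρ g x) = B.ρ g (e x)) : A ≅ B :=
  mkIso e.toIso fun g => by
    ext x
    exact he g x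

end

section

variable {G Y : Type u} [Group G] [MulAction G Y]

/-- The structure map of a `G`-set over `Y`. -/
def overProj (Z : Over (ofMulAction G Y)) (z : Z.left.V) : Y :=
  Z.hom.hom z

theorem overProj_ρ (Z : Over (ofMulAction G Y)) (g : G) (z : Z.left.V) :
    overProj Z (Z.left.ρ g z) = g • overProj Z z :=
  hom_ρ_apply Z.hom g z

theorem overProj_hom {Z Z' : Over (ofMulAction G Y)} (f : Z ⟶ Z') (z : Z.left.V) :
    overProj Z' (f.left.hom z) = overProj Z z :=
  congrArg (fun p : Z.left ⟶ ofMulAction G Y => p.hom z) (Over.w f)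

/-- The fiber over `a` of a `G`-set over `Y`, as a set with an action of the stabilizer of `a`. -/
def fiber (a : Y) (Z : Over (ofMulAction G Y)) :
    Action (Type u) (MulAction.stabilizer G a) :=
  ofFun {z : Z.left.V // overProj Z z = a}
    (fun h z => ⟨Z.left.ρ h.1 z.1, by rw [overProj_ρ, z.2]; exact h.2⟩)
    (fun z => Subtype.ext (ρ_one_apply _ _))
    (fun g h z => Subtype.ext (ρ_mul_apply _ _ _ _))

/-- Taking fibers over `a`, as a functor. -/
def fiberFunctor (a : Y) :
    Over (ofMulAction G Y) ⥤ Action (Type u) (MulAction.stabilizer G a) where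
  obj := fiber a
  map {Z Z'} f := homOfFun (A := fiber a Z) (B := fiber a Z')
    (fun z => ⟨f.left.hom z.1, (overProj_hom f z.1).trans z.2⟩)
    (fun h z => Subtype.ext (hom_ρ_apply f.left h.1 z.1))

variable {a : Y} {s : Y → G}

/-- The cocycle of a section `s` of the orbit map of `a`, with values in the stabilizer of `a`. -/
def sectionCocycle (hs : ∀ y, s y • a = y) (g : G) (y : Y) : MulAction.stabilizer G a :=
  ⟨(s (g • y))⁻¹ * g * s y, by
    rw [MulAction.mem_stabilizer_iff, mul_smul, mul_smul, hs, inv_smul_eq_iff, hs]⟩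

theorem sectionCocycle_one (hs : ∀ y, s y • a = y) (y : Y) : sectionCocycle hs 1 y = 1 :=
  Subtype.ext (by simp [sectionCocycle])

theorem sectionCocycle_mul (hs : ∀ y, s y • a = y) (g h : G) (y : Y) :
    sectionCocycle hs (g * h) y = sectionCocycle hs g (h • y) * sectionCocycle hs h y :=
  Subtype.ext (by simp [sectionCocycle, mul_smul, mul_assoc])

/-- The `G`-set over `Y` induced from a set with an action of the stabilizer of `a`. -/
def inducedOver (hs : ∀ y, s y • a = y) (W : Action (Type u) (MulAction.stabilizer G a)) :
    Over (ofMulAction G Y) :=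
  Over.mk (Y := ofFun (Y × W.V)
    (fun (g : G) p => (g • p.1, W.ρ (sectionCocycle hs g p.1) p.2))
    (fun p => Prod.ext (one_smul _ _) (by
      dsimp only
      rw [sectionCocycle_one, ρ_one_apply]))
    (fun g h p => Prod.ext (mul_smul _ _ _) (by
      dsimp only
      rw [sectionCocycle_mul, ρ_mul_apply])))
    (homOfFun (B := ofMulAction G Y) Prod.fst (fun _ _ => rfl))

/-- The value of a section at the base point lies in the stabilizer. -/
def sectionBase (hs : ∀ y, s y • a = y) : MulAction.stabilizer G a :=
  ⟨s a, hs a⟩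

theorem sectionCocycle_base (hs : ∀ y, s y • a = y) (h : MulAction.stabilizer G a) :
    sectionCocycle hs h.1 a = (sectionBase hs)⁻¹ * h * sectionBase hs :=
  Subtype.ext (by
    have : h.1 • a = a := h.2
    simp [sectionCocycle, sectionBase, this])

/-- The fiber over `a` of the induced `G`-set is the original set. -/
def fiberInducedOverIso (hs : ∀ y, s y • a = y)
    (W : Action (Type u) (MulAction.stabilizer G a)) :
    fiber a (inducedOver hs W) ≅ W :=
  isoOfEquiv (A := fiber a (inducedOver hs W)) (B := W)
    { toFun := fun z => W.ρ (sectionBase hs) z.1.2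
      invFun := fun w => ⟨(a, W.ρ (sectionBase hs)⁻¹ w), rfl⟩
      left_inv := by
        rintro ⟨⟨y, w⟩, rfl : y = a⟩
        exact Subtype.ext (Prod.ext rfl (ρ_inv_self_apply _ _))
      right_inv := fun w => ρ_self_inv_apply _ _ }
    (by
      rintro h ⟨⟨y, w⟩, rfl : y = a⟩
      change W.ρ (sectionBase hs) (W.ρ (sectionCocycle hs h.1 y) w) =
        W.ρ h (W.ρ (sectionBase hs) w)
      rw [sectionCocycle_base, ← ρ_mul_apply, ← ρ_mul_apply]
      congr 2
      group)

/-- Translation of a point of a `G`-set over `Y` to the fiber over `a`, along a section. -/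
def toFiber (hs : ∀ y, s y • a = y) (Z : Over (ofMulAction G Y)) (z : Z.left.V) :
    (fiber a Z).V :=
  ⟨Z.left.ρ (s (overProj Z z))⁻¹ z, by rw [overProj_ρ, inv_smul_eq_iff, hs]⟩

theorem ρ_toFiber (hs : ∀ y, s y • a = y) (Z : Over (ofMulAction G Y)) (z : Z.left.V) :
    Z.left.ρ (s (overProj Z z)) (toFiber hs Z z).1 = z :=
  ρ_self_inv_apply _ _

theorem toFiber_ρ (hs : ∀ y, s y • a = y) (Z : Over (ofMulAction G Y)) (g : G)
    (z : Z.left.V) :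
    toFiber hs Z (Z.left.ρ g z) =
      (fiber a Z).ρ (sectionCocycle hs g (overProj Z z)) (toFiber hs Z z) :=
  Subtype.ext (by
    change Z.left.ρ (s (overProj Z (Z.left.ρ g z)))⁻¹ (Z.left.ρ g z) =
      Z.left.ρ ((s (g • overProj Z z))⁻¹ * g * s (overProj Z z))
        (Z.left.ρ (s (overProj Z z))⁻¹ z)
    rw [overProj_ρ, ← ρ_mul_apply, ← ρ_mul_apply, mul_inv_cancel_right])

theorem toFiber_coe (hs : ∀ y, s y • a = y) (Z : Over (ofMulAction G Y))
    (z : (fiber a Z).V) :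
    toFiber hs Z z.1 = (fiber a Z).ρ (sectionBase hs)⁻¹ z :=
  Subtype.ext (by
    change Z.left.ρ (s (overProj Z z.1))⁻¹ z.1 = Z.left.ρ (s a)⁻¹ z.1
    rw [z.2])

/-- Extension of an equivariant map between fibers over `a` to the whole `G`-sets. -/
def extendFiberHom (hs : ∀ y, s y • a = y) {Z Z' : Over (ofMulAction G Y)}
    (f : fiber a Z ⟶ fiber a Z') : Z ⟶ Z' :=
  Over.homMk
    (homOfFun (fun z => Z'.left.ρ (s (overProj Z z)) (f.hom (toFiber hs Z z)).1)
      (fun g z => by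
        rw [toFiber_ρ, hom_ρ_apply, overProj_ρ]
        change Z'.left.ρ (s (g • overProj Z z))
          (Z'.left.ρ ((s (g • overProj Z z))⁻¹ * g * s (overProj Z z)) _) = _
        rw [← ρ_mul_apply, ← ρ_mul_apply, mul_assoc, mul_inv_cancel_left]))
    (by
      ext z
      change overProj Z' (Z'.left.ρ (s (overProj Z z)) (f.hom (toFiber hs Z z)).1) =
        overProj Z z
      rw [overProj_ρ, (f.hom (toFiber hs Z z)).2, hs])

theorem extendFiberHom_coe (hs : ∀ y, s y • a = y) {Z Z' : Over (ofMulAction G Y)}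
    (f : fiber a Z ⟶ fiber a Z') (z : (fiber a Z).V) :
    (extendFiberHom hs f).left.hom z.1 = (f.hom z).1 := by
  change Z'.left.ρ (s (overProj Z z.1)) (f.hom (toFiber hs Z z.1)).1 = (f.hom z).1
  have hz : overProj Z z.1 = a := z.2
  rw [toFiber_coe, hom_ρ_apply, hz]
  exact ρ_self_inv_apply (A := Z'.left) (s a) (f.hom z).1

theorem fiberFunctor_full (hs : ∀ y, s y • a = y) : (fiberFunctor (G := G) a).Full where
  map_surjective f := ⟨extendFiberHom hs f, by
    ext z
    exact Subtype.ext (extendFiberHom_coe hs f z)⟩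

theorem fiberFunctor_faithful (hs : ∀ y, s y • a = y) :
    (fiberFunctor (G := G) a).Faithful where
  map_injective {Z Z'} f f' h := by
    ext z
    have hz : f.left.hom (toFiber hs Z z).1 = f'.left.hom (toFiber hs Z z).1 :=
      congrArg (fun p : fiber a Z ⟶ fiber a Z' => (p.hom (toFiber hs Z z)).1) h
    change f.left.hom z = f'.left.hom z
    rw [← ρ_toFiber hs Z z, hom_ρ_apply, hom_ρ_apply, hz]

theorem fiberFunctor_essSurj (hs : ∀ y, s y • a = y) :
    (fiberFunctor (G := G) a).EssSurj where
  mem_essImage W := ⟨inducedOver hs W, ⟨fiberInducedOverIso hs W⟩⟩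

theorem fiberFunctor_isEquivalence (hs : ∀ y, s y • a = y) :
    (fiberFunctor (G := G) a).IsEquivalence where
  faithful := fiberFunctor_faithful hs
  full := fiberFunctor_full hs
  essSurj := fiberFunctor_essSurj hs

end

end Action

/-- Let `G` be a group and `Y` a connected `G`-set (nonempty with a
transitive `G`-action), `a ∈ Y`, and `H` the stabilizer of `a`. Then the slice category
of `G`-sets over `Y` is equivalent to the category of `H`-sets. -/
theorem slice_over_connected_equiv_stabilizer_sets
    {G Y : Type u} [Group G] [MulAction G Y]
    (hne : Nonempty Y) (htrans : ∀ y y' : Y, ∃ g : G, g • y = y') (a : Y) :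
    Nonempty (Over (Action.ofMulAction G Y) ≌
      Action (Type u) (MonCat.of (MulAction.stabilizer G a))) := by
  choose s hs using htrans a
  have := Action.fiberFunctor_isEquivalence hs
  exact ⟨(Action.fiberFunctor (G := G) a).asEquivalence⟩
end

section
/- Let G be a group, Y a connected G-set, a ∈ Y, and H ≤ G the stabilizer of a. Let π : Z → Y and π' : Z' → Y be G-equivariant maps. Then the fibers π⁻¹({a}) and π'⁻¹({a}) are H-stable, and the restriction map sending a G-equivariant map f : Z → Z' with π' ∘ f = π to its restriction π⁻¹({a}) → π'⁻¹({a}) is a bijection from the set of such maps f onto the set of H-equivariant maps π⁻¹({a}) → π'⁻¹({a}). -/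
/-- Transporting the value of a map on the fiber over `a`, equivariant under the stabilizer of `a`,
back along a group element that moves `z` into this fiber does not depend on that element. -/
theorem inv_smul_fiberMap_eq {G Y Z Z' : Type*} [Group G] [MulAction G Y] [MulAction G Z]
    [MulAction G Z'] {a : Y} {π : Z → Y} {π' : Z' → Y}
    (hπ : ∀ (g : G) (z : Z), π (g • z) = g • π z)
    (φ : {z : Z // π z = a} → {z' : Z' // π' z' = a})
    (hφ : ∀ h ∈ MulAction.stabilizer G a, ∀ (z : Z) (hz : π z = a) (hz' : π (h • z) = a),
      (φ ⟨h • z, hz'⟩ : Z') = h • (φ ⟨z, hz⟩ : Z'))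
    (z : Z) (g k : G) (hg : π (g • z) = a) (hk : π (k • z) = a) :
    g⁻¹ • (φ ⟨g • z, hg⟩ : Z') = k⁻¹ • (φ ⟨k • z, hk⟩ : Z') := by
  have hsmul : (k * g⁻¹) • g • z = k • z := by simp [smul_smul]
  have hmem : k * g⁻¹ ∈ MulAction.stabilizer G a := by
    rw [MulAction.mem_stabilizer_iff]
    nth_rewrite 1 [← hg]
    rw [← hπ, hsmul, hk]
  have h := hφ _ hmem (g • z) hg (by rw [hsmul, hk])
  simp only [hsmul] at h
  rw [h, smul_smul, inv_mul_cancel_left]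

/-- Let `G` be a group, `Y` a connected `G`-set, `a ∈ Y`, `H` the
stabilizer of `a`, and let `π : Z → Y`, `π' : Z' → Y` be `G`-equivariant maps.  Then the
fibers over `a` are `H`-stable, and restriction to the fibers over `a` is a bijection from
the set of `G`-equivariant maps `f : Z → Z'` with `π' ∘ f = π` onto the set of
`H`-equivariant maps `π⁻¹({a}) → π'⁻¹({a})`. -/
theorem restriction_to_fiber_bijective
    {G Y Z Z' : Type u} [Group G] [MulAction G Y] [MulAction G Z] [MulAction G Z']
    (hne : Nonempty Y) (htrans : ∀ y y' : Y, ∃ g : G, g • y = y') (a : Y)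
    (π : Z → Y) (π' : Z' → Y)
    (hπ : ∀ (g : G) (z : Z), π (g • z) = g • π z)
    (hπ' : ∀ (g : G) (z' : Z'), π' (g • z') = g • π' z') :
    (∀ h ∈ MulAction.stabilizer G a, ∀ z : Z, π z = a → π (h • z) = a) ∧
    (∀ h ∈ MulAction.stabilizer G a, ∀ z' : Z', π' z' = a → π' (h • z') = a) ∧
    Function.Bijective
      (fun f : {f : Z → Z' //
          (∀ (g : G) (z : Z), f (g • z) = g • f z) ∧ ∀ z : Z, π' (f z) = π z} =>
        (⟨fun z => ⟨f.1 z.1, by rw [f.2.2]; exact z.2⟩, by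
            intro h hh z hz hz'
            exact f.2.1 h z⟩ :
          {φ : {z : Z // π z = a} → {z' : Z' // π' z' = a} //
            ∀ h ∈ MulAction.stabilizer G a, ∀ (z : Z) (hz : π z = a)
              (hz' : π (h • z) = a),
              (φ ⟨h • z, hz'⟩ : Z') = h • (φ ⟨z, hz⟩ : Z')})) := by
  refine ⟨fun h hh z hz => by rw [hπ, hz]; exact hh,
    fun h hh z hz => by rw [hπ', hz]; exact hh, ?_, ?_⟩
  · intro f₁ f₂ heq
    refine Subtype.ext (funext fun z => ?_)
    obtain ⟨g, hg⟩ := htrans (π z) a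
    have h := congrArg (fun φ => (φ.1 ⟨g • z, by rw [hπ, hg]⟩ : Z')) heq
    simp only [f₁.2.1, f₂.2.1] at h
    exact smul_left_cancel g h
  · rintro ⟨φ, hφ⟩
    choose c hc using fun y => htrans y a
    have hcz (z : Z) : π (c (π z) • z) = a := by rw [hπ, hc]
    refine ⟨⟨fun z => (c (π z))⁻¹ • (φ ⟨c (π z) • z, hcz z⟩ : Z'), fun g z => ?_, fun z => ?_⟩, ?_⟩
    · have hmul : π ((c (π (g • z)) * g) • z) = a := by rw [mul_smul, hcz]
      beta_reduce
      rw [inv_smul_fiberMap_eq hπ φ hφ z _ _ (hcz z) hmul]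
      simp [mul_smul]
    · rw [hπ', (φ _).2, inv_smul_eq_iff, hc]
    · refine Subtype.ext (funext fun ⟨z, hz⟩ => Subtype.ext ?_)
      have h := inv_smul_fiberMap_eq hπ φ hφ z _ 1 (hcz z) (by rw [one_smul, hz])
      simpa using h
end

section
/- Let G be a group, Y a connected G-set, a ∈ Y, and H ≤ G the stabilizer of a. Then for every H-set U there exist a G-set Z, a G-equivariant map π : Z → Y, and an H-equivariant bijection π⁻¹({a}) ≃ U. (One may take Z = Y × U with the action g·(y,u) = (g·y, γ_{g·y}⁻¹ g γ_y · u), where for each y ∈ Y an element γ_y ∈ G with y = γ_y·a is chosen, with γ_a = 1.) -/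
/-- A section `γ` of the orbit map `g ↦ g • a` defines a cocycle
`(g, y) ↦ γ (g • y)⁻¹ * g * γ y` on `Y` with values in the stabilizer of `a`. -/
def orbitSectionCocycle {G Y : Type*} [Group G] [MulAction G Y] {a : Y} (γ : Y → G)
    (hγ : ∀ y, γ y • a = y) (g : G) (y : Y) : MulAction.stabilizer G a :=
  ⟨(γ (g • y))⁻¹ * g * γ y, by
    rw [MulAction.mem_stabilizer_iff, mul_smul, mul_smul, hγ, inv_smul_eq_iff, hγ]⟩

theorem orbitSectionCocycle_one {G Y : Type*} [Group G] [MulAction G Y] {a : Y} (γ : Y → G)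
    (hγ : ∀ y, γ y • a = y) (y : Y) : orbitSectionCocycle γ hγ 1 y = 1 := by
  ext
  simp [orbitSectionCocycle]

theorem orbitSectionCocycle_mul {G Y : Type*} [Group G] [MulAction G Y] {a : Y} (γ : Y → G)
    (hγ : ∀ y, γ y • a = y) (g g' : G) (y : Y) :
    orbitSectionCocycle γ hγ (g * g') y =
      orbitSectionCocycle γ hγ g (g' • y) * orbitSectionCocycle γ hγ g' y := by
  ext
  simp [orbitSectionCocycle, mul_smul, mul_assoc]

theorem orbitSectionCocycle_stabilizer {G Y : Type*} [Group G] [MulAction G Y] {a : Y}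
    (γ : Y → G) (hγ : ∀ y, γ y • a = y) (hγa : γ a = 1) (h : MulAction.stabilizer G a) :
    orbitSectionCocycle γ hγ h a = h := by
  ext
  simp [orbitSectionCocycle, MulAction.mem_stabilizer_iff.mp h.2, hγa]

/-- The action of `G` on `Y × U` twisted by the cocycle of a section of the orbit map. -/
abbrev orbitSectionMulAction {G Y U : Type*} [Group G] [MulAction G Y] {a : Y}
    [MulAction (MulAction.stabilizer G a) U] (γ : Y → G) (hγ : ∀ y, γ y • a = y) :
    MulAction G (Y × U) where
  smul g z := (g • z.1, orbitSectionCocycle γ hγ g z.1 • z.2)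
  one_smul z := Prod.ext (one_smul G z.1) <| by
    change orbitSectionCocycle γ hγ 1 z.1 • z.2 = z.2
    rw [orbitSectionCocycle_one, one_smul]
  mul_smul g g' z := Prod.ext (mul_smul g g' z.1) <| by
    change orbitSectionCocycle γ hγ (g * g') z.1 • z.2 =
      orbitSectionCocycle γ hγ g (g' • z.1) • orbitSectionCocycle γ hγ g' z.1 • z.2
    rw [orbitSectionCocycle_mul, mul_smul]


/-- Let `G` be a group, `Y` a connected `G`-set, `a ∈ Y`, and `H` the
stabilizer of `a`.  Then every `H`-set `U` arises, up to `H`-equivariant bijection, as the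
fiber over `a` of a `G`-equivariant map `π : Z → Y` from some `G`-set `Z` (the `G`-action
on `Z` being recorded as a homomorphism `ρ : G →* Equiv.Perm Z`). -/
theorem every_stabilizer_set_is_a_fiber
    {G Y : Type u} [Group G] [MulAction G Y]
    (hne : Nonempty Y) (htrans : ∀ y y' : Y, ∃ g : G, g • y = y') (a : Y)
    (U : Type u) [MulAction (MulAction.stabilizer G a) U] :
    ∃ (Z : Type u) (ρ : G →* Equiv.Perm Z) (π : Z → Y),
      (∀ (g : G) (z : Z), π (ρ g z) = g • π z) ∧
      ∃ e : {z : Z // π z = a} ≃ U,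
        ∀ (h : MulAction.stabilizer G a) (z : Z) (hz : π z = a)
          (hz' : π (ρ (h : G) z) = a),
          e ⟨ρ (h : G) z, hz'⟩ = h • e ⟨z, hz⟩ := by
  classical
  obtain ⟨γ, hγ, hγa⟩ : ∃ γ : Y → G, (∀ y, γ y • a = y) ∧ γ a = 1 := by
    choose δ hδ using htrans a
    refine ⟨Function.update δ a 1, fun y => ?_, Function.update_self ..⟩
    rcases eq_or_ne y a with rfl | hy
    · simp
    · simp [hy, hδ]
  refine ⟨Y × U, @MulAction.toPermHom G (Y × U) _ (orbitSectionMulAction γ hγ), Prod.fst,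
    fun _ _ => rfl, ⟨fun z => z.1.2, fun u => ⟨(a, u), rfl⟩, ?_, fun _ => rfl⟩, ?_⟩
  · rintro ⟨⟨_, u⟩, rfl⟩
    rfl
  · rintro h ⟨y, u⟩ hz -
    obtain rfl : y = a := hz
    change orbitSectionCocycle γ hγ h y • u = h • u
    rw [orbitSectionCocycle_stabilizer γ hγ hγa]
end

section
/- Let k be a field, k̄ a separable closure of k, and A a commutative k-algebra. Let B be a commutative algebra over k̄ ⊗_k A that is finite étale (i.e., B is a finitely generated module over k̄ ⊗_k A and is an étale algebra over k̄ ⊗_k A). Then there exist a finite subextension k' of k̄/k and a finite étale commutative algebra B' over k' ⊗_k A such that B is isomorphic, as an algebra over k̄ ⊗_k A, to the base change B' ⊗_{k' ⊗_k A} (k̄ ⊗_k A). -/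
open TensorProduct

/-- Descent data for an algebra `B` over `k̄ ⊗_k A`: a finite subextension `k'` of
`k̄ / k` (an intermediate field, recorded as a field with a tower of embeddings
`k ⊆ k' ⊆ k̄`) and a finite étale algebra `B'` over `k' ⊗_k A` whose base change along
the canonical map `k' ⊗_k A → k̄ ⊗_k A` is isomorphic to `B` as a `k̄ ⊗_k A`-algebra. -/
structure FiniteEtaleDescentData
    (k kbar A B : Type u) [Field k] [Field kbar] [Algebra k kbar]
    [CommRing A] [Algebra k A] [CommRing B] [Algebra (kbar ⊗[k] A) B] :
    Type (u + 1) where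
  /-- the finite subextension of `k̄ / k` -/
  k' : Type u
  [fieldK' : Field k']
  [algK : Algebra k k']
  [algKbar : Algebra k' kbar]
  [tower : IsScalarTower k k' kbar]
  finDim : FiniteDimensional k k'
  /-- the algebra over `k' ⊗_k A` descending `B` -/
  B' : Type u
  [commRing : CommRing B']
  [alg : Algebra (k' ⊗[k] A) B']
  finite : Module.Finite (k' ⊗[k] A) B'
  etale : Algebra.Etale (k' ⊗[k] A) B'
  iso :
    letI : Algebra (k' ⊗[k] A) (kbar ⊗[k] A) :=
      (Algebra.TensorProduct.map (IsScalarTower.toAlgHom k k' kbar)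
        (AlgHom.id k A)).toRingHom.toAlgebra
    Nonempty (B ≃ₐ[kbar ⊗[k] A] ((kbar ⊗[k] A) ⊗[k' ⊗[k] A] B'))

/-- For a tower `k ⊆ k' ⊆ K` of fields, the canonical map `k' ⊗_k A → K ⊗_k A` is
faithfully flat. -/
lemma TensorProduct.faithfullyFlat_map_toAlgHom_id (k k' K A : Type*) [Field k] [Field k'] [Field K]
    [Algebra k k'] [Algebra k' K] [Algebra k K] [IsScalarTower k k' K] [CommRing A] [Algebra k A] :
    (Algebra.TensorProduct.map (IsScalarTower.toAlgHom k k' K)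
      (AlgHom.id k A)).toRingHom.FaithfullyFlat := by
  let _ : Algebra (k' ⊗[k] A) (K ⊗[k] A) :=
    (Algebra.TensorProduct.map (IsScalarTower.toAlgHom k k' K) (AlgHom.id k A)).toRingHom.toAlgebra
  let e : (k' ⊗[k] A) ⊗[k'] K ≃+* K ⊗[k] A :=
    (Algebra.TensorProduct.comm k' (k' ⊗[k] A) K).toRingEquiv.trans
      (Algebra.TensorProduct.cancelBaseChange k k' K K A).toRingEquiv
  let e' : (k' ⊗[k] A) ⊗[k'] K ≃ₐ[k' ⊗[k] A] K ⊗[k] A :=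
    AlgEquiv.ofRingEquiv (f := e) fun x ↦ by
      induction x with
      | zero => simp
      | add x y hx hy => simp only [map_add, hx, hy]
      | tmul x a =>
        change Algebra.TensorProduct.cancelBaseChange k k' K K A (1 ⊗ₜ (x ⊗ₜ a)) =
          algebraMap k' K x ⊗ₜ a
        simp [Algebra.algebraMap_eq_smul_one]
  exact Module.FaithfullyFlat.of_linearEquiv _ _ e'.symm.toLinearEquiv

/-- If `K / k` is algebraic, finitely many elements of `K ⊗_k A` all lie in the image of
`k' ⊗_k A` for some finite subextension `k'` of `K / k`. -/
lemma TensorProduct.exists_finiteDimensional_subset_range_map {k K A : Type*} [Field k] [Field K]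
    [Algebra k K] [Algebra.IsAlgebraic k K] [CommRing A] [Algebra k A]
    (s : Set (K ⊗[k] A)) (hs : s.Finite) :
    ∃ k' : IntermediateField k K, FiniteDimensional k k' ∧
      s ⊆ Set.range (Algebra.TensorProduct.map (IsScalarTower.toAlgHom k k' K)
        (AlgHom.id k A)) := by
  obtain ⟨M, hMfin, hM⟩ := TensorProduct.exists_finite_submodule_left_of_setFinite s hs
  obtain ⟨t, rfl⟩ := Module.Finite.iff_fg.mp hMfin
  let k' := IntermediateField.adjoin k (t : Set K)
  have hle : Submodule.span k (t : Set K) ≤ k'.toSubalgebra.toSubmodule :=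
    Submodule.span_le.mpr (IntermediateField.subset_adjoin k _)
  refine ⟨k', IntermediateField.finiteDimensional_adjoin
    fun x _ ↦ Algebra.IsIntegral.isIntegral x, fun x hx ↦ ?_⟩
  obtain ⟨y, rfl⟩ := hM hx
  clear hx
  refine ⟨(Submodule.inclusion hle).rTensor A y, ?_⟩
  induction y with
  | zero => simp
  | add x y hx hy =>
    simp only [map_add]
    exact congrArg₂ (· + ·) hx hy
  | tmul x a => rfl

/-- Let `k` be a field with separable closure `k̄` and `A` a
commutative `k`-algebra.  Every finite étale commutative algebra `B` over `k̄ ⊗_k A` is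
defined over `k' ⊗_k A` for some finite subextension `k'` of `k̄ / k`. -/
theorem finite_etale_descends_to_finite_subextension
    (k kbar A B : Type u) [Field k] [Field kbar] [Algebra k kbar]
    [IsSepClosure k kbar]
    [CommRing A] [Algebra k A] [CommRing B] [Algebra (kbar ⊗[k] A) B]
    [Module.Finite (kbar ⊗[k] A) B] [Algebra.Etale (kbar ⊗[k] A) B] :
    Nonempty (FiniteEtaleDescentData k kbar A B) := by
  have : Algebra.IsAlgebraic k kbar :=
    (IsSepClosure.isSeparable (k := k) (K := kbar)).isAlgebraic
  let P := Algebra.Presentation.ofFinitePresentation (kbar ⊗[k] A) B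
  obtain ⟨k', hfin, hk'⟩ :=
    TensorProduct.exists_finiteDimensional_subset_range_map P.coeffs P.finite_coeffs
  let _ : Algebra (k' ⊗[k] A) (kbar ⊗[k] A) :=
    (Algebra.TensorProduct.map (IsScalarTower.toAlgHom k k' kbar)
      (AlgHom.id k A)).toRingHom.toAlgebra
  let _ : Algebra (k' ⊗[k] A) B := Algebra.compHom B (algebraMap (k' ⊗[k] A) (kbar ⊗[k] A))
  have : IsScalarTower (k' ⊗[k] A) (kbar ⊗[k] A) B := .of_algebraMap_eq fun _ ↦ rfl
  have : Module.FaithfullyFlat (k' ⊗[k] A) (kbar ⊗[k] A) :=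
    TensorProduct.faithfullyFlat_map_toAlgHom_id k k' kbar A
  have : P.HasCoeffs (k' ⊗[k] A) := ⟨hk'⟩
  let B' := P.ModelOfHasCoeffs (k' ⊗[k] A)
  let e : (kbar ⊗[k] A) ⊗[k' ⊗[k] A] B' ≃ₐ[kbar ⊗[k] A] B :=
    P.tensorModelOfHasCoeffsEquiv (k' ⊗[k] A)
  have : Module.Finite (kbar ⊗[k] A) ((kbar ⊗[k] A) ⊗[k' ⊗[k] A] B') :=
    .equiv e.symm.toLinearEquiv
  have : Algebra.Etale (kbar ⊗[k] A) ((kbar ⊗[k] A) ⊗[k' ⊗[k] A] B') := .of_equiv e.symm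
  exact ⟨{
    k' := k'
    finDim := hfin
    B' := B'
    finite := .of_finite_tensorProduct_of_faithfullyFlat (kbar ⊗[k] A)
    etale := .of_etale_tensorProduct_of_faithfullyFlat (kbar ⊗[k] A)
    iso := ⟨e.symm⟩ }⟩
end
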